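/- For all α > 0, β₁, β₂ ∈ (0,1) and c > 0, the trajectory of Adam without bias correction started on the 2-cycle is periodic and does not converge to the minimizer: the sequence defined by x₀ = x̃₁ and x_{t+1} = T̄₀(x_t) satisfies x_{2t} = x̃₁ and x_{2t+1} = x̃₂ for all t ∈ ℕ; in particular the weight component w_t alternates between w̃ ≠ 0 and −w̃ and does not converge to 0, the unique minimizer of f(w) = (1/2)·c·w². -/

import Mathlib

/-- The autonomous Adam map (without bias correction) with hyperparameters
`α, β₁, β₂, ε` for the scalar quadratic objective `f(w) = (1/2)·c·w²`,
acting on states `x = (m, v, w)`. -/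
noncomputable def adamMap (α β₁ β₂ c ε : ℝ) (x : ℝ × ℝ × ℝ) : ℝ × ℝ × ℝ :=
  (β₁ * x.1 + (1 - β₁) * c * x.2.2,
   β₂ * x.2.1 + (1 - β₂) * c ^ 2 * x.2.2 ^ 2,
   x.2.2 - α * (β₁ * x.1 + (1 - β₁) * c * x.2.2) /
     Real.sqrt (β₂ * x.2.1 + (1 - β₂) * c ^ 2 * x.2.2 ^ 2 + ε))

noncomputable def mTilde (α β₁ c : ℝ) : ℝ := α * c * (1 - β₁) ^ 2 / (2 * (1 + β₁) ^ 2)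
noncomputable def vTilde (α β₁ c : ℝ) : ℝ := α ^ 2 * c ^ 2 * (1 - β₁) ^ 2 / (4 * (1 + β₁) ^ 2)
noncomputable def wTilde (α β₁ : ℝ) : ℝ := -(α * (1 - β₁)) / (2 * (1 + β₁))

/-- First point of the 2-cycle. -/
noncomputable def xTilde₁ (α β₁ c : ℝ) : ℝ × ℝ × ℝ :=
  (mTilde α β₁ c, vTilde α β₁ c, wTilde α β₁)

/-- Second point of the 2-cycle. -/
noncomputable def xTilde₂ (α β₁ c : ℝ) : ℝ × ℝ × ℝ :=
  (-mTilde α β₁ c, vTilde α β₁ c, -wTilde α β₁)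

lemma vTilde_eq_sq (α β₁ c : ℝ) :
    vTilde α β₁ c = (α * c * (1 - β₁) / (2 * (1 + β₁))) ^ 2 := by
  unfold vTilde
  rw [div_pow]
  congr 1 <;> ring

lemma sq_mul_wTilde_sq (α β₁ c : ℝ) : c ^ 2 * wTilde α β₁ ^ 2 = vTilde α β₁ c := by
  rw [vTilde_eq_sq, wTilde]
  ring

lemma momentum_update_tilde {β₁ : ℝ} (α c : ℝ) (h : 1 + β₁ ≠ 0) :
    β₁ * mTilde α β₁ c + (1 - β₁) * c * wTilde α β₁ = -mTilde α β₁ c := by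
  unfold mTilde wTilde
  field_simp
  ring

lemma sqrt_vTilde {α β₁ c : ℝ} (hα : 0 ≤ α) (hβ₁ : β₁ ∈ Set.Ioo (0 : ℝ) 1) (hc : 0 ≤ c) :
    Real.sqrt (vTilde α β₁ c) = α * c * (1 - β₁) / (2 * (1 + β₁)) := by
  have h₁ : 0 ≤ 1 - β₁ := by linarith [hβ₁.2]
  have h₂ : 0 ≤ 1 + β₁ := by linarith [hβ₁.1]
  rw [vTilde_eq_sq, Real.sqrt_sq (by positivity)]

lemma adamMap_xTilde₁ {α β₁ c : ℝ} (β₂ : ℝ) (hα : 0 < α) (hβ₁ : β₁ ∈ Set.Ioo (0 : ℝ) 1)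
    (hc : 0 < c) : adamMap α β₁ β₂ c 0 (xTilde₁ α β₁ c) = xTilde₂ α β₁ c := by
  have h₁ : 1 - β₁ ≠ 0 := by linarith [hβ₁.2]
  have h₂ : 1 + β₁ ≠ 0 := by linarith [hβ₁.1]
  have hv : β₂ * vTilde α β₁ c + (1 - β₂) * c ^ 2 * wTilde α β₁ ^ 2 = vTilde α β₁ c := by
    linear_combination (1 - β₂) * sq_mul_wTilde_sq α β₁ c
  simp only [adamMap, xTilde₁, xTilde₂, momentum_update_tilde α c h₂, hv, add_zero,
    sqrt_vTilde hα.le hβ₁ hc.le, Prod.mk.injEq, true_and]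
  unfold mTilde wTilde
  field_simp
  ring

/-- The Adam map commutes with the symmetry `(m, v, w) ↦ (-m, v, -w)`. -/
lemma adamMap_neg (α β₁ β₂ c ε m v w : ℝ) :
    adamMap α β₁ β₂ c ε (-m, v, -w) =
      (-(adamMap α β₁ β₂ c ε (m, v, w)).1, (adamMap α β₁ β₂ c ε (m, v, w)).2.1,
        -(adamMap α β₁ β₂ c ε (m, v, w)).2.2) := by
  simp only [adamMap, neg_sq, Prod.mk.injEq, true_and]
  constructor <;> ring

lemma adamMap_xTilde₂ {α β₁ c : ℝ} (β₂ : ℝ) (hα : 0 < α) (hβ₁ : β₁ ∈ Set.Ioo (0 : ℝ) 1)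
    (hc : 0 < c) : adamMap α β₁ β₂ c 0 (xTilde₂ α β₁ c) = xTilde₁ α β₁ c := by
  have h := adamMap_xTilde₁ β₂ hα hβ₁ hc
  rw [xTilde₁] at h
  rw [xTilde₂, adamMap_neg, h]
  simp [xTilde₁, xTilde₂]

lemma wTilde_ne_zero {α β₁ : ℝ} (hα : 0 < α) (hβ₁ : β₁ ∈ Set.Ioo (0 : ℝ) 1) :
    wTilde α β₁ ≠ 0 := by
  have h₁ : 0 < 1 - β₁ := by linarith [hβ₁.2]
  have h₂ : 0 < 1 + β₁ := by linarith [hβ₁.1]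
  exact div_ne_zero (neg_ne_zero.mpr (by positivity)) (by positivity)

/-- The trajectory of Adam without bias correction started on the 2-cycle is
periodic with period 2: `x_{2t} = x̃₁`, `x_{2t+1} = x̃₂`; in particular the weight
component alternates between `w̃ ≠ 0` and `−w̃` and does not converge to `0`,
the unique minimizer of `f(w) = (1/2)·c·w²`. -/
theorem adam_two_cycle_orbit_does_not_converge (α β₁ β₂ c : ℝ) (hα : 0 < α)
    (hβ₁ : β₁ ∈ Set.Ioo (0 : ℝ) 1) (hβ₂ : β₂ ∈ Set.Ioo (0 : ℝ) 1) (hc : 0 < c)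
    (x : ℕ → ℝ × ℝ × ℝ) (hx0 : x 0 = xTilde₁ α β₁ c)
    (hstep : ∀ t : ℕ, x (t + 1) = adamMap α β₁ β₂ c 0 (x t)) :
    (∀ t : ℕ, x (2 * t) = xTilde₁ α β₁ c ∧ x (2 * t + 1) = xTilde₂ α β₁ c) ∧
    wTilde α β₁ ≠ 0 ∧
    ¬ Filter.Tendsto (fun t : ℕ => (x t).2.2) Filter.atTop (nhds 0) ∧
    (∀ u : ℝ, u ≠ 0 → (1 / 2 : ℝ) * c * 0 ^ 2 < (1 / 2 : ℝ) * c * u ^ 2) := by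
  have horbit : ∀ t : ℕ, x (2 * t) = xTilde₁ α β₁ c ∧ x (2 * t + 1) = xTilde₂ α β₁ c := by
    have heven : ∀ t : ℕ, x (2 * t) = xTilde₁ α β₁ c := by
      intro t
      induction t with
      | zero => exact hx0
      | succ t ih =>
        rw [show 2 * (t + 1) = 2 * t + 1 + 1 by ring, hstep, hstep, ih,
          adamMap_xTilde₁ β₂ hα hβ₁ hc, adamMap_xTilde₂ β₂ hα hβ₁ hc]
    exact fun t => ⟨heven t, by rw [hstep, heven, adamMap_xTilde₁ β₂ hα hβ₁ hc]⟩
  refine ⟨horbit, wTilde_ne_zero hα hβ₁, fun hlim => ?_, fun u hu => ?_⟩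
  · have hsub := hlim.comp (Filter.tendsto_id.const_mul_atTop' (two_pos : (0 : ℕ) < 2))
    have hconst : (fun t : ℕ => (x t).2.2) ∘ (fun t => 2 * id t) = fun _ => wTilde α β₁ := by
      funext t
      simp [(horbit t).1, xTilde₁]
    rw [hconst] at hsub
    exact wTilde_ne_zero hα hβ₁ (tendsto_nhds_unique tendsto_const_nhds hsub)
  · have : 0 < (1 / 2 : ℝ) * c * u ^ 2 := by positivity
    simpa using this
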